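/- Let (X, hgt) be an even quasiparabolic W-set whose height function is bounded below, and let x < y in the Bruhat order with the interval [x,y] = {z ∈ X : x ≤ z ≤ y} finite. Then [x,y] is balanced: the number of z ∈ [x,y] with hgt(z) even equals the number of z ∈ [x,y] with hgt(z) odd. Equivalently, the Möbius function of the Bruhat order is μ(x,y) = (−1)^{hgt(y)−hgt(x)} if x ≤ y and 0 otherwise. -/

import Mathlib

open CoxeterSystem

variable {B W : Type*} [Group W] {M : CoxeterMatrix B}

/-- A scaled `W`-set: heights change by at most 1 under simple reflections. -/
def IsScaled (cs : CoxeterSystem M W) {X : Type*} [MulAction W X] (hgt : X → ℤ) : Prop :=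
  ∀ (b : B) (x : X), |hgt (cs.simple b • x) - hgt x| ≤ 1

/-- A quasiparabolic `W`-set: scaled, plus (QP1) and (QP2). -/
def IsQuasiparabolic (cs : CoxeterSystem M W) {X : Type*} [MulAction W X] (hgt : X → ℤ) : Prop :=
  IsScaled cs hgt ∧
  (∀ (r : W) (x : X), cs.IsReflection r → hgt (r • x) = hgt x → r • x = x) ∧
  (∀ (r : W) (b : B) (x : X), cs.IsReflection r → hgt x < hgt (r • x) →
    hgt (cs.simple b • r • x) < hgt (cs.simple b • x) → r • x = cs.simple b • x)
/-- The Bruhat order on a quasiparabolic `W`-set: the reflexive–transitive closure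
of the relation `x ≺ r • x` for reflections `r` with `hgt x < hgt (r • x)`. -/
def BruhatLE (cs : CoxeterSystem M W) {X : Type*} [MulAction W X] (hgt : X → ℤ) :
    X → X → Prop :=
  Relation.ReflTransGen (fun x y => ∃ r : W, cs.IsReflection r ∧ y = r • x ∧ hgt x < hgt y)

/-- The strict Bruhat order. -/
def BruhatLT (cs : CoxeterSystem M W) {X : Type*} [MulAction W X] (hgt : X → ℤ)
    (x y : X) : Prop :=
  BruhatLE cs hgt x y ∧ x ≠ y

/-- An even scaled `W`-set: all stabilizers consist of elements of even length. -/
def IsEvenWSet (cs : CoxeterSystem M W) {X : Type*} [MulAction W X] : Prop :=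
  ∀ (w : W) (x : X), w • x = x → Even (cs.length w)

section Bruhat

variable {cs : CoxeterSystem M W} {X : Type*} [MulAction W X] {hgt : X → ℤ}

theorem BruhatLE.hgt_le {x y : X} (h : BruhatLE cs hgt x y) : hgt x ≤ hgt y := by
  induction h with
  | refl => exact le_rfl
  | tail _ h ih =>
    obtain ⟨r, _, _, hlt⟩ := h
    omega

theorem BruhatLE.exists_smul_eq {x y : X} (h : BruhatLE cs hgt x y) : ∃ w : W, w • x = y := by
  induction h with
  | refl => exact ⟨1, one_smul _ _⟩
  | tail _ h ih =>
    obtain ⟨w, rfl⟩ := ih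
    obtain ⟨r, _, rfl, _⟩ := h
    exact ⟨r * w, mul_smul _ _ _⟩

theorem bruhatLE_of_isReflection (hqp : IsQuasiparabolic cs hgt) {r : W} (hr : cs.IsReflection r)
    {x : X} (h : hgt x ≤ hgt (r • x)) : BruhatLE cs hgt x (r • x) := by
  rcases h.lt_or_eq with h | h
  · exact Relation.ReflTransGen.single ⟨r, hr, rfl, h⟩
  · rw [hqp.2.1 r x hr h.symm]
    exact Relation.ReflTransGen.refl

theorem BruhatLE.eq_of_hgt_le {x y : X} (h : BruhatLE cs hgt x y) (hle : hgt y ≤ hgt x) :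
    x = y := by
  rcases Relation.ReflTransGen.cases_head h with h | ⟨z, ⟨r, _, _, hlt⟩, hzy⟩
  · exact h
  · have := BruhatLE.hgt_le hzy
    omega

theorem CoxeterSystem.simple_smul_simple_smul (cs : CoxeterSystem M W) (b : B) (x : X) :
    cs.simple b • cs.simple b • x = x := by
  simp [smul_smul]

theorem smul_smul_eq_conj_smul (w r : W) (x : X) : w • r • x = (w * r * w⁻¹) • w • x := by
  simp [smul_smul]

/-- One step of the lifting property. -/
theorem smul_eq_or_simple_smul_bruhatLE (hqp : IsQuasiparabolic cs hgt) (b : B) {r : W}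
    (hr : cs.IsReflection r) {x : X} (h : hgt x < hgt (r • x)) :
    r • x = cs.simple b • x ∨ BruhatLE cs hgt (cs.simple b • x) (cs.simple b • r • x) := by
  by_cases hlt : hgt (cs.simple b • r • x) < hgt (cs.simple b • x)
  · exact Or.inl (hqp.2.2 r b x hr h hlt)
  · right
    rw [smul_smul_eq_conj_smul] at hlt ⊢
    exact bruhatLE_of_isReflection hqp (hr.conj _) (not_lt.1 hlt)

open Classical in
/-- The lower of the two elements `x` and `s • x`. -/
noncomputable def simpleMin (cs : CoxeterSystem M W) (hgt : X → ℤ) (b : B) (x : X) : X :=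
  if hgt (cs.simple b • x) < hgt x then cs.simple b • x else x

open Classical in
/-- The higher of the two elements `x` and `s • x`. -/
noncomputable def simpleMax (cs : CoxeterSystem M W) (hgt : X → ℤ) (b : B) (x : X) : X :=
  if hgt (cs.simple b • x) < hgt x then x else cs.simple b • x

theorem simpleMin_bruhatLE (hqp : IsQuasiparabolic cs hgt) (b : B) (x : X) :
    BruhatLE cs hgt (simpleMin cs hgt b x) x := by
  unfold simpleMin
  split_ifs with h
  · have := bruhatLE_of_isReflection hqp (x := cs.simple b • x) (cs.isReflection_simple b)
    rw [cs.simple_smul_simple_smul] at this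
    exact this h.le
  · exact Relation.ReflTransGen.refl

theorem bruhatLE_simpleMax (hqp : IsQuasiparabolic cs hgt) (b : B) (x : X) :
    BruhatLE cs hgt x (simpleMax cs hgt b x) := by
  unfold simpleMax
  split_ifs with h
  · exact Relation.ReflTransGen.refl
  · exact bruhatLE_of_isReflection hqp (cs.isReflection_simple b) (not_lt.1 h)

/-- The lifting property of the Bruhat order. -/
theorem BruhatLE.lifting (hqp : IsQuasiparabolic cs hgt) (b : B) {x y : X}
    (h : BruhatLE cs hgt x y) :
    BruhatLE cs hgt (simpleMin cs hgt b x) (simpleMin cs hgt b y) ∧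
      BruhatLE cs hgt (simpleMax cs hgt b x) (simpleMax cs hgt b y) := by
  induction h with
  | refl => exact ⟨Relation.ReflTransGen.refl, Relation.ReflTransGen.refl⟩
  | @tail u v _ h ih =>
    suffices H : BruhatLE cs hgt (simpleMin cs hgt b u) (simpleMin cs hgt b v) ∧
        BruhatLE cs hgt (simpleMax cs hgt b u) (simpleMax cs hgt b v) from
      ⟨Relation.ReflTransGen.trans ih.1 H.1, Relation.ReflTransGen.trans ih.2 H.2⟩
    obtain ⟨r, hr, rfl, hlt⟩ := h
    have huv : BruhatLE cs hgt u (r • u) := bruhatLE_of_isReflection hqp hr hlt.le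
    have humin := simpleMin_bruhatLE hqp b u
    have hvmax := bruhatLE_simpleMax hqp b (r • u)
    have humax := bruhatLE_simpleMax hqp b u
    have hvmin := simpleMin_bruhatLE hqp b (r • u)
    rcases smul_eq_or_simple_smul_bruhatLE hqp b hr hlt with heq | hle
    · rw [heq] at hlt ⊢
      have h₁ : ¬ hgt (cs.simple b • u) < hgt u := hlt.not_gt
      simp only [simpleMin, simpleMax, cs.simple_smul_simple_smul, if_pos hlt, if_neg h₁]
      exact ⟨Relation.ReflTransGen.refl, Relation.ReflTransGen.refl⟩
    · clear ih
      unfold simpleMin simpleMax at *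
      split_ifs at * with h₁ h₂ h₂
      · exact ⟨hle, huv⟩
      · exact ⟨Relation.ReflTransGen.trans humin huv, Relation.ReflTransGen.trans huv hvmax⟩
      · exact ⟨Relation.ReflTransGen.trans humax hle, Relation.ReflTransGen.trans hle hvmin⟩
      · exact ⟨huv, hle⟩

/-- The exchange property of a quasiparabolic set. -/
theorem exists_wordProd_smul_eq_of_hgt_lt (hqp : IsQuasiparabolic cs hgt) {r : W}
    (hr : cs.IsReflection r) {x : X} (hx : hgt x ≤ hgt (r • x)) (ω : List B)
    (h : hgt (cs.wordProd ω • r • x) < hgt (cs.wordProd ω • x)) :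
    ∃ ω' : List B, ω'.length < ω.length ∧ cs.wordProd ω • r • x = cs.wordProd ω' • x := by
  induction ω with
  | nil =>
    simp only [cs.wordProd_nil, one_smul] at h
    omega
  | cons b ω ih =>
    by_cases hlt : hgt (cs.wordProd ω • r • x) < hgt (cs.wordProd ω • x)
    · obtain ⟨ω', hlen, heq⟩ := ih hlt
      exact ⟨b :: ω', by simpa using hlen, by rw [cs.wordProd_cons, cs.wordProd_cons, mul_smul,
        mul_smul, heq]⟩
    · refine ⟨ω, by simp, ?_⟩
      rw [cs.wordProd_cons, mul_smul] at h ⊢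
      rw [mul_smul] at h
      have hc := hr.conj (cs.wordProd ω)
      rw [smul_smul_eq_conj_smul (cs.wordProd ω) r x] at h hlt ⊢
      rcases (not_lt.1 hlt).lt_or_eq with hlt' | heq
      · rw [hqp.2.2 _ b _ hc hlt' h, cs.simple_smul_simple_smul]
      · rw [hqp.2.1 _ _ hc heq.symm] at h
        exact absurd h (lt_irrefl _)

/-- An element without descents is the only element of minimal height in its orbit. -/
theorem eq_of_forall_hgt_le_of_forall_not_descent (hqp : IsQuasiparabolic cs hgt) {x₀ : X}
    (hx₀ : ∀ w : W, hgt x₀ ≤ hgt (w • x₀)) (n : ℕ) (ω : List B) (hn : ω.length ≤ n)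
    (hy : ∀ b, ¬ hgt (cs.simple b • cs.wordProd ω • x₀) ≤ hgt (cs.wordProd ω • x₀)) :
    cs.wordProd ω • x₀ = x₀ := by
  induction n generalizing ω with
  | zero =>
    obtain rfl := List.eq_nil_of_length_eq_zero (Nat.le_zero.1 hn)
    simp
  | succ n ih =>
    cases ω with
    | nil => simp
    | cons b ω =>
      have hb := hy b
      have hconj : cs.wordProd (b :: ω) • x₀ =
          cs.wordProd ω • ((cs.wordProd ω)⁻¹ * cs.simple b * (cs.wordProd ω)) • x₀ := by
        simp [cs.wordProd_cons, smul_smul, mul_assoc]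
      have hr : cs.IsReflection ((cs.wordProd ω)⁻¹ * cs.simple b * cs.wordProd ω) := by
        simpa using (cs.isReflection_simple b).conj (cs.wordProd ω)⁻¹
      have hlt : hgt (cs.wordProd (b :: ω) • x₀) < hgt (cs.wordProd ω • x₀) := by
        rw [cs.wordProd_cons, mul_smul, cs.simple_smul_simple_smul] at hb
        rw [cs.wordProd_cons, mul_smul]
        exact not_le.1 hb
      rw [hconj] at hlt
      obtain ⟨ω', hlen, heq⟩ := exists_wordProd_smul_eq_of_hgt_lt hqp hr (hx₀ _) ω hlt
      rw [← hconj] at heq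
      rw [heq] at hy ⊢
      refine ih ω' ?_ hy
      simp only [List.length_cons] at hn
      omega

theorem hgt_simple_smul_ne (hqp : IsQuasiparabolic cs hgt) (heven : IsEvenWSet cs (X := X))
    (b : B) (x : X) : hgt (cs.simple b • x) ≠ hgt x := by
  intro h
  have := heven _ x (hqp.2.1 _ x (cs.isReflection_simple b) h)
  rw [cs.length_simple] at this
  exact absurd this (by decide)

/-- A Bruhat-nonminimal element has a descent. -/
theorem BruhatLT.exists_descent (hqp : IsQuasiparabolic cs hgt)
    (heven : IsEvenWSet cs (X := X)) (hbdd : ∃ m : ℤ, ∀ x : X, m ≤ hgt x) {x y : X}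
    (h : BruhatLT cs hgt x y) : ∃ b, hgt (cs.simple b • y) < hgt y := by
  by_contra! hno
  obtain ⟨m, hm⟩ := hbdd
  obtain ⟨k, ⟨v, hv⟩, hk⟩ := Int.exists_least_of_bdd (P := fun k => ∃ w : W, hgt (w • y) = k)
    ⟨m, by rintro _ ⟨w, rfl⟩; exact hm _⟩ ⟨_, 1, rfl⟩
  obtain ⟨ω, hω⟩ := cs.wordProd_surjective v⁻¹
  have hyω : cs.wordProd ω • v • y = y := by simp [hω]
  have hyv : y = v • y := by
    have := eq_of_forall_hgt_le_of_forall_not_descent hqp (x₀ := v • y)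
      (fun w => hv ▸ hk _ ⟨w * v, by rw [mul_smul]⟩) _ ω le_rfl
      (by
        intro b hb
        rw [hyω] at hb
        exact hgt_simple_smul_ne hqp heven b y (le_antisymm hb (hno b)))
    rwa [hyω] at this
  obtain ⟨w, hw⟩ := h.1.exists_smul_eq
  refine h.2 (h.1.eq_of_hgt_le ?_)
  rw [hyv, hv]
  exact hk _ ⟨w⁻¹, by simp [← hw]⟩

/-- The Bruhat interval `[x, y]`. -/
def bruhatInterval (cs : CoxeterSystem M W) (hgt : X → ℤ) (x y : X) : Set X :=
  {z : X | BruhatLE cs hgt x z ∧ BruhatLE cs hgt z y}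

open Classical in
/-- The sign `(-1) ^ hgt z`. -/
noncomputable def hgtSign (hgt : X → ℤ) (z : X) : ℤ :=
  if Even (hgt z) then 1 else -1

theorem hgtSign_simple_smul (hqp : IsQuasiparabolic cs hgt) (heven : IsEvenWSet cs (X := X))
    (b : B) (x : X) : hgtSign hgt (cs.simple b • x) = - hgtSign hgt x := by
  have hne := hgt_simple_smul_ne hqp heven b x
  have habs := abs_le.1 (hqp.1 b x)
  unfold hgtSign
  split_ifs with h₁ h₂ h₂
  · rw [Int.even_iff] at h₁ h₂
    omega
  · simp
  · simp
  · rw [Int.even_iff] at h₁ h₂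
    omega

theorem finsum_hgtSign_eq_zero_of_simple_smul_mem (hqp : IsQuasiparabolic cs hgt)
    (heven : IsEvenWSet cs (X := X)) (b : B) {S : Set X} (hfin : S.Finite)
    (hS : ∀ z ∈ S, cs.simple b • z ∈ S) : ∑ᶠ z ∈ S, hgtSign hgt z = 0 := by
  have hneg : ∑ᶠ z ∈ S, hgtSign hgt z = ∑ᶠ z ∈ S, - hgtSign hgt z := by
    refine finsum_mem_eq_of_bijOn (fun z => cs.simple b • z) ⟨hS, ?_, ?_⟩ ?_
    · exact (MulAction.injective _).injOn
    · exact fun z hz => ⟨cs.simple b • z, hS z hz, cs.simple_smul_simple_smul b z⟩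
    · intro z _
      rw [hgtSign_simple_smul hqp heven, neg_neg]
  rw [finsum_mem_neg_distrib _ hfin] at hneg
  omega

/-- If `s` is a descent of `y` but not of `x`, then `s` preserves `[x, y]`. -/
theorem simple_smul_mem_bruhatInterval (hqp : IsQuasiparabolic cs hgt) {b : B} {x y z : X}
    (hx : hgt x < hgt (cs.simple b • x)) (hy : hgt (cs.simple b • y) < hgt y)
    (hz : z ∈ bruhatInterval cs hgt x y) : cs.simple b • z ∈ bruhatInterval cs hgt x y := by
  have h₁ := (hz.1.lifting hqp b).1
  have h₂ := (hz.2.lifting hqp b).2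
  have h₃ := bruhatLE_simpleMax hqp b z
  have h₄ := simpleMin_bruhatLE hqp b z
  simp only [simpleMin, simpleMax, if_neg hx.not_gt, if_pos hy] at h₁ h₂ h₃ h₄
  split_ifs at h₁ h₂ h₃ h₄ with hlt
  · exact ⟨h₁, Relation.ReflTransGen.trans h₄ h₂⟩
  · exact ⟨Relation.ReflTransGen.trans h₁ h₃, h₂⟩

theorem finsum_hgtSign_bruhatInterval_eq_zero (hqp : IsQuasiparabolic cs hgt)
    (heven : IsEvenWSet cs (X := X)) {m : ℤ} (hm : ∀ x : X, m ≤ hgt x) (n : ℕ) (x y : X)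
    (hn : hgt y < m + n) (hxy : BruhatLT cs hgt x y)
    (hfin : (bruhatInterval cs hgt x y).Finite) :
    ∑ᶠ z ∈ bruhatInterval cs hgt x y, hgtSign hgt z = 0 := by
  induction n generalizing x y with
  | zero =>
    have := hm y
    push_cast at hn
    omega
  | succ n ih =>
    obtain ⟨b, hy⟩ := hxy.exists_descent hqp heven ⟨m, hm⟩
    rcases (hgt_simple_smul_ne hqp heven b x).lt_or_gt with hx | hx
    swap
    · exact finsum_hgtSign_eq_zero_of_simple_smul_mem hqp heven b hfin
        fun z => simple_smul_mem_bruhatInterval hqp hx hy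
    have hsx : BruhatLE cs hgt (cs.simple b • x) x := by
      simpa only [simpleMin, if_pos hx] using simpleMin_bruhatLE hqp b x
    have hsy : BruhatLE cs hgt (cs.simple b • y) y := by
      simpa only [simpleMin, if_pos hy] using simpleMin_bruhatLE hqp b y
    have hsxy : BruhatLE cs hgt (cs.simple b • x) (cs.simple b • y) := by
      simpa only [simpleMin, if_pos hx, if_pos hy] using (hxy.1.lifting hqp b).1
    set s := cs.simple b with hs
    have hssx : hgt (s • x) < hgt (s • s • x) := by
      rwa [hs, cs.simple_smul_simple_smul]
    have hunion : bruhatInterval cs hgt x y ∪ bruhatInterval cs hgt (s • x) (s • y) =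
        bruhatInterval cs hgt (s • x) y := by
      ext z
      constructor
      · rintro (h | h)
        · exact ⟨Relation.ReflTransGen.trans hsx h.1, h.2⟩
        · exact ⟨h.1, Relation.ReflTransGen.trans h.2 hsy⟩
      · intro h
        have h₁ := (h.1.lifting hqp b).2
        have h₂ := (h.2.lifting hqp b).1
        simp only [simpleMin, simpleMax, ← hs, if_neg hssx.not_gt, if_pos hy] at h₁ h₂
        rw [hs, cs.simple_smul_simple_smul, ← hs] at h₁
        split_ifs at h₁ h₂ with hlt
        · exact Or.inl ⟨h₁, h.2⟩
        · exact Or.inr ⟨h.1, h₂⟩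
    have hinter : bruhatInterval cs hgt x y ∩ bruhatInterval cs hgt (s • x) (s • y) =
        bruhatInterval cs hgt x (s • y) := by
      ext z
      exact ⟨fun h => ⟨h.1.1, h.2.2⟩, fun h => ⟨⟨h.1, Relation.ReflTransGen.trans h.2 hsy⟩,
        ⟨Relation.ReflTransGen.trans hsx h.1, h.2⟩⟩⟩
    have hfin₁ : (bruhatInterval cs hgt (s • x) y).Finite := by
      refine (hfin.union (hfin.preimage (f := fun z => s • z)
        (MulAction.injective s).injOn)).subset fun z h => ?_
      have h₁ := (h.1.lifting hqp b).2
      have h₂ := (simple_smul_mem_bruhatInterval hqp hssx hy h).2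
      simp only [simpleMax, ← hs, if_neg hssx.not_gt] at h₁
      rw [hs, cs.simple_smul_simple_smul, ← hs] at h₁
      split_ifs at h₁ with hlt
      · exact Or.inl ⟨h₁, h.2⟩
      · exact Or.inr ⟨h₁, h₂⟩
    have hfin₂ : (bruhatInterval cs hgt (s • x) (s • y)).Finite :=
      hfin₁.subset (hunion ▸ Set.subset_union_right)
    have hn' : hgt (s • y) < m + n := by
      push_cast at hn
      omega
    have hsum := finsum_mem_union_inter (f := hgtSign hgt) hfin hfin₂
    rw [hunion, hinter, finsum_hgtSign_eq_zero_of_simple_smul_mem hqp heven b hfin₁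
        fun z => simple_smul_mem_bruhatInterval hqp hssx hy,
      ih _ _ hn' ⟨hsxy, fun h => hxy.2 (MulAction.injective s h)⟩ hfin₂, zero_add, add_zero]
      at hsum
    rw [← hsum]
    by_cases hle : BruhatLE cs hgt x (s • y)
    · refine ih _ _ hn' ⟨hle, ?_⟩ (hfin.subset (hinter ▸ Set.inter_subset_left))
      rintro rfl
      rw [hs, cs.simple_smul_simple_smul, ← hs] at hx
      omega
    · have hempty : bruhatInterval cs hgt x (s • y) = ∅ :=
        Set.eq_empty_of_forall_notMem fun z h => hle (Relation.ReflTransGen.trans h.1 h.2)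
      rw [hempty, finsum_mem_empty]

theorem finsum_hgtSign_eq_ncard_sub_ncard {S : Set X} (hfin : S.Finite) :
    ∑ᶠ z ∈ S, hgtSign hgt z =
      ({z | z ∈ S ∧ Even (hgt z)}.ncard : ℤ) - {z | z ∈ S ∧ Odd (hgt z)}.ncard := by
  have hE : {z | z ∈ S ∧ Even (hgt z)}.Finite := hfin.subset fun z h => h.1
  have hO : {z | z ∈ S ∧ Odd (hgt z)}.Finite := hfin.subset fun z h => h.1
  have hS : S = {z | z ∈ S ∧ Even (hgt z)} ∪ {z | z ∈ S ∧ Odd (hgt z)} := by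
    ext z
    have := Int.even_or_odd (hgt z)
    simp only [Set.mem_union, Set.mem_ofPred_eq]
    tauto
  have hdisj : Disjoint {z | z ∈ S ∧ Even (hgt z)} {z | z ∈ S ∧ Odd (hgt z)} :=
    Set.disjoint_left.2 fun z h h' => Int.not_even_iff_odd.2 h'.2 h.2
  have hsumE : ∑ᶠ z ∈ {z | z ∈ S ∧ Even (hgt z)}, hgtSign hgt z =
      ({z | z ∈ S ∧ Even (hgt z)}.ncard : ℤ) := by
    have hsign : ∀ z ∈ {z | z ∈ S ∧ Even (hgt z)}, hgtSign hgt z = 1 :=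
      fun z hz => if_pos hz.2
    rw [finsum_mem_congr rfl hsign, finsum_mem_eq_finite_toFinset_sum _ hE,
      Set.ncard_eq_toFinset_card _ hE]
    simp
  have hsumO : ∑ᶠ z ∈ {z | z ∈ S ∧ Odd (hgt z)}, hgtSign hgt z =
      - ({z | z ∈ S ∧ Odd (hgt z)}.ncard : ℤ) := by
    have hsign : ∀ z ∈ {z | z ∈ S ∧ Odd (hgt z)}, hgtSign hgt z = -1 :=
      fun z hz => if_neg (Int.not_even_iff_odd.2 hz.2)
    rw [finsum_mem_congr rfl hsign,
      finsum_mem_eq_finite_toFinset_sum _ hO, Set.ncard_eq_toFinset_card _ hO]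
    simp
  calc ∑ᶠ z ∈ S, hgtSign hgt z
      = ∑ᶠ z ∈ {z | z ∈ S ∧ Even (hgt z)} ∪ {z | z ∈ S ∧ Odd (hgt z)}, hgtSign hgt z := by
        rw [← hS]
    _ = _ := by rw [finsum_mem_union hdisj hE hO, hsumE, hsumO, sub_eq_add_neg]

end Bruhat

/-- in an even, bounded-below quasiparabolic `W`-set, every nontrivial
finite Bruhat interval `[x, y]` is balanced: it contains as many elements of even
height as of odd height (equivalently, the Möbius function is
`μ(x,y) = (−1)^{hgt y − hgt x}` for `x ≤ y`). -/
theorem bruhat_interval_balanced (cs : CoxeterSystem M W) {X : Type*} [MulAction W X]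
    (hgt : X → ℤ) (hqp : IsQuasiparabolic cs hgt) (heven : IsEvenWSet cs (X := X))
    (hbdd : ∃ m : ℤ, ∀ x : X, m ≤ hgt x)
    (x y : X) (hxy : BruhatLT cs hgt x y)
    (hfin : {z : X | BruhatLE cs hgt x z ∧ BruhatLE cs hgt z y}.Finite) :
    {z : X | (BruhatLE cs hgt x z ∧ BruhatLE cs hgt z y) ∧ Even (hgt z)}.ncard =
      {z : X | (BruhatLE cs hgt x z ∧ BruhatLE cs hgt z y) ∧ Odd (hgt z)}.ncard := by
  obtain ⟨m, hm⟩ := hbdd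
  have hzero := finsum_hgtSign_bruhatInterval_eq_zero hqp heven hm (hgt y - m + 1).toNat x y
    (by have := hm y; omega) hxy hfin
  have hcard := finsum_hgtSign_eq_ncard_sub_ncard (hgt := hgt)
    (S := bruhatInterval cs hgt x y) hfin
  rw [hzero] at hcard
  exact_mod_cast (sub_eq_zero.1 hcard.symm)
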